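/- arXiv:1705.11182 — 2 statements merged into one kernel-verified Lean document; each statement's English description precedes it below -/
import Mathlib

section
/- For every u ≥ 0 and α ∈ (0,1), the function e^{-u^α} admits the integral representation e^{-u^α} = ∫_0^∞ e^{-us} g(α,s) ds, where g(α,s) = (1/π) ∫_0^∞ e^{-sv} e^{-v^α cos(πα)} sin(v^α sin(πα)) dv. -/
open MeasureTheory Real Set

/-- The strictly α-stable density `g(α,s)` given by Pollard's inversion formula. -/
noncomputable def stableDensity (α s : ℝ) : ℝ :=
  (1 / π) * ∫ v in Ioi (0 : ℝ),
    Real.exp (-s * v) * Real.exp (-(v ^ α) * Real.cos (π * α)) *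
      Real.sin ((v ^ α) * Real.sin (π * α))

open Filter Topology

theorem integrable_line_of_decay {f : ℂ → ℂ} {a b C δ y : ℝ} (hδ : 0 < δ)
    (hf : DifferentiableOn ℂ f {w | w.im ∈ Icc a b})
    (htop : ∀ᶠ x : ℝ in atTop, ∀ y ∈ Icc a b, ‖f (x + y * Complex.I)‖ ≤ C * rexp (-δ * x))
    (hbot : ∀ᶠ x : ℝ in atBot, ∀ y ∈ Icc a b, ‖f (x + y * Complex.I)‖ ≤ C * rexp (δ * x))
    (hy : y ∈ Icc a b) : Integrable (fun x : ℝ ↦ f (x + y * Complex.I)) := by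
  have hc : Continuous fun x : ℝ ↦ f (x + y * Complex.I) := by
    refine hf.continuousOn.comp_continuous (by fun_prop) fun x ↦ ?_
    simpa using hy
  refine hc.locallyIntegrable.integrable_of_isBigO_atBot_atTop
    (g := fun x ↦ rexp (δ * x)) (g' := fun x ↦ rexp (-δ * x)) ?_ ?_ ?_ ?_
  · refine Asymptotics.IsBigO.of_bound C ?_
    filter_upwards [hbot] with x hx
    simpa using hx y hy
  · exact ⟨Iic 0, Iic_mem_atBot 0, integrableOn_exp_mul_Iic hδ 0⟩
  · refine Asymptotics.IsBigO.of_bound C ?_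
    filter_upwards [htop] with x hx
    simpa using hx y hy
  · exact ⟨Ioi 0, Ioi_mem_atTop 0, integrableOn_exp_mul_Ioi (neg_lt_zero.2 hδ) 0⟩

/-- The integrals of a holomorphic function over the two edges of a horizontal strip agree
if the function decays exponentially along the strip. -/
theorem integral_line_eq_of_decay {f : ℂ → ℂ} {a b C δ : ℝ} (hab : a ≤ b) (hδ : 0 < δ)
    (hf : DifferentiableOn ℂ f {w | w.im ∈ Icc a b})
    (htop : ∀ᶠ x : ℝ in atTop, ∀ y ∈ Icc a b, ‖f (x + y * Complex.I)‖ ≤ C * rexp (-δ * x))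
    (hbot : ∀ᶠ x : ℝ in atBot, ∀ y ∈ Icc a b, ‖f (x + y * Complex.I)‖ ≤ C * rexp (δ * x)) :
    ∫ x : ℝ, f (x + a * Complex.I) = ∫ x : ℝ, f (x + b * Complex.I) := by
  have key (T : ℝ) := Complex.integral_boundary_rect_eq_zero_of_differentiableOn f
    (-T + a * Complex.I) (T + b * Complex.I) (hf.mono fun w hw ↦ by
      simpa [Complex.mem_reProdIm, uIcc_of_le hab] using hw.2)
  have hC : Tendsto (fun T : ℝ ↦ C * rexp (-δ * T) * |b - a|) atTop (𝓝 0) := by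
    have : Tendsto (fun T : ℝ ↦ rexp (-δ * T)) atTop (𝓝 0) :=
      tendsto_exp_atBot.comp (tendsto_id.const_mul_atTop_of_neg (neg_lt_zero.2 hδ))
    simpa using (this.const_mul C).mul_const |b - a|
  have h1 : Tendsto (fun T : ℝ ↦ ∫ y in a..b, f (T + y * Complex.I)) atTop (𝓝 0) := by
    refine squeeze_zero_norm' ?_ hC
    filter_upwards [htop] with T hT
    refine intervalIntegral.norm_integral_le_of_norm_le_const fun y hy ↦ hT y ?_
    rw [uIoc_of_le hab] at hy
    exact Ioc_subset_Icc_self hy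
  have h2 : Tendsto (fun T : ℝ ↦ ∫ y in a..b, f (-T + y * Complex.I)) atTop (𝓝 0) := by
    refine squeeze_zero_norm' ?_ hC
    filter_upwards [tendsto_neg_atTop_atBot.eventually hbot] with T hT
    refine intervalIntegral.norm_integral_le_of_norm_le_const fun y hy ↦ ?_
    rw [uIoc_of_le hab] at hy
    simpa using hT y (Ioc_subset_Icc_self hy)
  have hi {y : ℝ} (hy : y ∈ Icc a b) := intervalIntegral_tendsto_integral
    (integrable_line_of_decay hδ hf htop hbot hy) tendsto_neg_atTop_atBot tendsto_id
  have h3 := (((hi (left_mem_Icc.2 hab)).sub (hi (right_mem_Icc.2 hab))).add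
    (h1.const_smul Complex.I)).sub (h2.const_smul Complex.I)
  have h4 := tendsto_nhds_unique h3 (tendsto_const_nhds.congr fun T ↦ by
    simpa using (key T).symm)
  simpa [sub_eq_zero] using h4

theorem eventually_mul_add_exp_le {α κ : ℝ} (hα1 : α < 1) (hκ : 0 < κ) (m c : ℝ) :
    ∀ᶠ x : ℝ in atTop, m * x + c * rexp (α * x) ≤ κ * rexp x := by
  have h1 : Tendsto (fun x : ℝ ↦ x * rexp (-x)) atTop (𝓝 0) := by
    simpa using tendsto_pow_mul_exp_neg_atTop_nhds_zero 1
  have h2 : Tendsto (fun x : ℝ ↦ rexp ((α - 1) * x)) atTop (𝓝 0) :=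
    tendsto_exp_atBot.comp (tendsto_id.const_mul_atTop_of_neg (by linarith))
  have h3 : Tendsto (fun x : ℝ ↦ m * (x * rexp (-x)) + c * rexp ((α - 1) * x)) atTop (𝓝 0) := by
    simpa using (h1.const_mul m).add (h2.const_mul c)
  filter_upwards [h3.eventually_le_const hκ] with x hx
  calc m * x + c * rexp (α * x)
      = (m * (x * rexp (-x)) + c * rexp ((α - 1) * x)) * rexp x := by
        rw [show (α - 1) * x = α * x - x by ring, exp_sub, exp_neg]
        field_simp
    _ ≤ κ * rexp x := by gcongr

theorem eventually_mul_le_exp {α κ : ℝ} (hα : 0 < α) (hκ : 0 < κ) (m : ℝ) :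
    ∀ᶠ x : ℝ in atTop, m * x ≤ κ * rexp (α * x) := by
  have h1 : Tendsto (fun x : ℝ ↦ m / α * (x * rexp (-x))) atTop (𝓝 0) := by
    simpa using (tendsto_pow_mul_exp_neg_atTop_nhds_zero 1).const_mul (m / α)
  have h2 := h1.comp (tendsto_id.const_mul_atTop hα)
  filter_upwards [h2.eventually_le_const hκ] with x hx
  calc m * x = (m / α * (α * x * rexp (-(α * x)))) * rexp (α * x) := by
        rw [exp_neg]; field_simp
    _ ≤ κ * rexp (α * x) := by gcongr; exact hx

theorem integral_Ioi_eq_integral_exp (h : ℝ → ℝ) :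
    ∫ v in Ioi (0 : ℝ), h v = ∫ x : ℝ, rexp x * h (rexp x) := by
  have := integral_image_eq_integral_abs_deriv_smul (s := univ) (f := rexp) MeasurableSet.univ
    (fun x _ ↦ (hasDerivAt_exp x).hasDerivWithinAt) exp_injective.injOn h
  simpa [image_univ, abs_of_pos (exp_pos _)] using this

/-- The integrand `e^{sz} e^{-z^α} dz` of Pollard's contour integral, in the logarithmic
coordinate `z = e^w`, where it is entire. -/
noncomputable def stableKernel (α s : ℝ) (w : ℂ) : ℂ :=
  Complex.exp (s * Complex.exp w) * Complex.exp (-Complex.exp (α * w)) * Complex.exp w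

theorem differentiable_stableKernel (α s : ℝ) : Differentiable ℂ (stableKernel α s) := by
  unfold stableKernel; fun_prop

theorem norm_exp_neg_exp_mul (α x y : ℝ) :
    ‖Complex.exp (-Complex.exp (α * (x + y * Complex.I)))‖ =
      rexp (-(rexp (α * x) * cos (α * y))) := by
  simp [Complex.norm_exp, Complex.exp_re]

theorem norm_stableKernel (α s x y : ℝ) :
    ‖stableKernel α s (x + y * Complex.I)‖ =
      rexp (s * (rexp x * cos y) - rexp (α * x) * cos (α * y) + x) := by
  rw [stableKernel, norm_mul, norm_mul, norm_exp_neg_exp_mul, exp_add, sub_eq_add_neg, exp_add]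
  simp [Complex.norm_exp, Complex.exp_re]

theorem norm_stableKernel_le_of_nonpos {α s x y : ℝ} (hα : 0 < α) (hs : 0 ≤ s) (hx : x ≤ 0)
    (hy : cos y ≤ 0) : ‖stableKernel α s (x + y * Complex.I)‖ ≤ rexp 1 * rexp (1 * x) := by
  rw [norm_stableKernel, ← exp_add, exp_le_exp]
  have h1 : s * (rexp x * cos y) ≤ 0 :=
    mul_nonpos_of_nonneg_of_nonpos hs (mul_nonpos_of_nonneg_of_nonpos (exp_pos x).le hy)
  have h2 : rexp (α * x) ≤ 1 := exp_le_one_iff.2 (mul_nonpos_of_nonneg_of_nonpos hα.le hx)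
  nlinarith [neg_one_le_cos (α * y), exp_pos (α * x)]

theorem exists_angle_between {α : ℝ} (hα : α ∈ Ioo (0 : ℝ) 1) :
    ∃ θ : ℝ, π / 2 < θ ∧ θ < π ∧ α * θ < π / 2 := by
  obtain ⟨θ, h1, h2⟩ := exists_between (show π / 2 < min π (π / 2 / α) by
    rw [lt_min_iff]
    refine ⟨by linarith [pi_pos], ?_⟩
    rw [lt_div_iff₀ hα.1]
    nlinarith [pi_pos, hα.2])
  rw [lt_min_iff] at h2
  refine ⟨θ, h1, h2.1, ?_⟩
  have := (lt_div_iff₀ hα.1).1 h2.2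
  linarith

theorem cos_nonpos_of_mem_Icc {a b y : ℝ} (ha : π / 2 ≤ a) (hb : b ≤ π) (hy : y ∈ Icc a b) :
    cos y ≤ 0 :=
  cos_nonpos_of_pi_div_two_le_of_le (ha.trans hy.1) (by linarith [hy.2, pi_pos])

theorem eventually_atBot_norm_stableKernel_le {α s a b : ℝ} (hα : 0 < α) (hs : 0 ≤ s)
    (ha : π / 2 ≤ a) (hb : b ≤ π) :
    ∀ᶠ x : ℝ in atBot, ∀ y ∈ Icc a b,
      ‖stableKernel α s (x + y * Complex.I)‖ ≤ rexp 1 * rexp (1 * x) := by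
  filter_upwards [eventually_le_atBot 0] with x hx y hy
  exact norm_stableKernel_le_of_nonpos hα hs hx (cos_nonpos_of_mem_Icc ha hb hy)

theorem eventually_atTop_norm_stableKernel_le_left {α s θ : ℝ} (hα : 0 < α) (hs : 0 ≤ s)
    (hθ : θ ≤ π) (hαθ : α * θ < π / 2) :
    ∀ᶠ x : ℝ in atTop, ∀ y ∈ Icc (π / 2) θ,
      ‖stableKernel α s (x + y * Complex.I)‖ ≤ rexp 1 * rexp (-1 * x) := by
  by_cases h : π / 2 ≤ θ
  swap
  · simp [Icc_eq_empty h]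
  have hκ : 0 < cos (α * θ) := cos_pos_of_mem_Ioo ⟨by nlinarith [pi_pos], hαθ⟩
  filter_upwards [eventually_mul_le_exp hα hκ 2] with x hx y hy
  rw [norm_stableKernel, ← exp_add, exp_le_exp]
  have h1 : s * (rexp x * cos y) ≤ 0 :=
    mul_nonpos_of_nonneg_of_nonpos hs (mul_nonpos_of_nonneg_of_nonpos (exp_pos x).le
      (cos_nonpos_of_mem_Icc le_rfl hθ hy))
  have h2 : cos (α * θ) ≤ cos (α * y) := by
    apply cos_le_cos_of_nonneg_of_le_pi
    · have := hy.1; have := pi_pos; exact mul_nonneg hα.le (by linarith)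
    · linarith [pi_pos]
    · exact mul_le_mul_of_nonneg_left hy.2 hα.le
  nlinarith [exp_pos (α * x)]

theorem eventually_atTop_norm_stableKernel_le_right {α s θ : ℝ} (hα : α < 1) (hs : 0 < s)
    (hθ : π / 2 < θ) :
    ∀ᶠ x : ℝ in atTop, ∀ y ∈ Icc θ π,
      ‖stableKernel α s (x + y * Complex.I)‖ ≤ rexp 1 * rexp (-1 * x) := by
  by_cases h : θ ≤ π
  swap
  · simp [Icc_eq_empty h]
  have hκ : cos θ < 0 := cos_neg_of_pi_div_two_lt_of_lt hθ (by linarith [pi_pos])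
  filter_upwards [eventually_mul_add_exp_le hα (mul_pos hs (neg_pos.2 hκ)) 2 1] with x hx y hy
  rw [norm_stableKernel, ← exp_add, exp_le_exp]
  have h1 : cos y ≤ cos θ :=
    cos_le_cos_of_nonneg_of_le_pi (by linarith [pi_pos]) hy.2 hy.1
  have h2 : s * (rexp x * cos y) ≤ s * (rexp x * cos θ) := by gcongr
  nlinarith [neg_one_le_cos (α * y), exp_pos (α * x)]

theorem integrable_stableKernel_pi_div_two {α s : ℝ} (hα : α ∈ Ioo (0 : ℝ) 1) (hs : 0 ≤ s) :
    Integrable fun x : ℝ ↦ stableKernel α s (x + (π / 2 : ℝ) * Complex.I) :=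
  integrable_line_of_decay one_pos (differentiable_stableKernel α s).differentiableOn
    (eventually_atTop_norm_stableKernel_le_left hα.1 hs (by linarith [pi_pos])
      (by nlinarith [pi_pos, hα.2]))
    (eventually_atBot_norm_stableKernel_le hα.1 hs le_rfl (by linarith [pi_pos]))
    (right_mem_Icc.2 le_rfl)

theorem integrable_stableKernel_pi {α s : ℝ} (hα : α ∈ Ioo (0 : ℝ) 1) (hs : 0 < s) :
    Integrable fun x : ℝ ↦ stableKernel α s (x + π * Complex.I) :=
  integrable_line_of_decay one_pos (differentiable_stableKernel α s).differentiableOn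
    (eventually_atTop_norm_stableKernel_le_right hα.2 hs (by linarith [pi_pos]))
    (eventually_atBot_norm_stableKernel_le hα.1 hs.le (by linarith [pi_pos]) le_rfl)
    (right_mem_Icc.2 le_rfl)

theorem integral_stableKernel_pi {α s : ℝ} (hα : α ∈ Ioo (0 : ℝ) 1) (hs : 0 < s) :
    ∫ x : ℝ, stableKernel α s (x + π * Complex.I) =
      ∫ x : ℝ, stableKernel α s (x + (π / 2 : ℝ) * Complex.I) := by
  obtain ⟨θ, h1, h2, h3⟩ := exists_angle_between hα
  have hd := (differentiable_stableKernel α s)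
  rw [integral_line_eq_of_decay h1.le one_pos hd.differentiableOn
      (eventually_atTop_norm_stableKernel_le_left hα.1 hs.le h2.le h3)
      (eventually_atBot_norm_stableKernel_le hα.1 hs.le le_rfl h2.le),
    integral_line_eq_of_decay h2.le one_pos hd.differentiableOn
      (eventually_atTop_norm_stableKernel_le_right hα.2 hs h1)
      (eventually_atBot_norm_stableKernel_le hα.1 hs.le h1.le le_rfl)]

theorem im_stableKernel_pi (α s x : ℝ) :
    (stableKernel α s (x + π * Complex.I)).im =
      rexp x * (rexp (-s * rexp x) * rexp (-(rexp (α * x)) * cos (π * α)) *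
        sin (rexp (α * x) * sin (π * α))) := by
  have h1 : Complex.exp (x + π * Complex.I) = ((-rexp x : ℝ) : ℂ) := by
    rw [Complex.exp_add, Complex.exp_pi_mul_I]; push_cast; ring
  have h2 : (s : ℂ) * ((-rexp x : ℝ) : ℂ) = ((-s * rexp x : ℝ) : ℂ) := by push_cast; ring
  rw [stableKernel, h1, h2, ← Complex.ofReal_exp, Complex.im_mul_ofReal, Complex.im_ofReal_mul,
    Complex.exp_im]
  simp only [Complex.neg_re, Complex.neg_im, Complex.exp_re, Complex.exp_im]
  simp [sin_neg, mul_comm α π]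
  ring

theorem stableDensity_eq_integral_real (α s : ℝ) :
    stableDensity α s = (1 / π) * ∫ x : ℝ, (stableKernel α s (x + π * Complex.I)).im := by
  rw [stableDensity, integral_Ioi_eq_integral_exp]
  simp_rw [im_stableKernel_pi, ← exp_mul, mul_comm _ α]

theorem stableDensity_eq_im_integral {α s : ℝ} (hα : α ∈ Ioo (0 : ℝ) 1) (hs : 0 < s) :
    stableDensity α s =
      (1 / π) * (∫ x : ℝ, stableKernel α s (x + (π / 2 : ℝ) * Complex.I)).im := by
  rw [stableDensity_eq_integral_real, ← integral_stableKernel_pi hα hs]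
  congr 1
  exact integral_im (integrable_stableKernel_pi hα hs)

theorem stableKernel_eq (α s : ℝ) (w : ℂ) :
    stableKernel α s w = Complex.exp (Complex.exp w * s) * stableKernel α 0 w := by
  simp [stableKernel, mul_assoc, mul_comm (s : ℂ)]

theorem exp_add_pi_div_two_mul_I (x : ℝ) :
    Complex.exp (x + (π / 2 : ℝ) * Complex.I) = rexp x * Complex.I := by
  rw [Complex.exp_add]; push_cast; rw [Complex.exp_pi_div_two_mul_I]

theorem integrable_exp_mul_stableKernel {α u : ℝ} (hα : α ∈ Ioo (0 : ℝ) 1) (hu : 0 < u) :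
    Integrable (fun p : ℝ × ℝ ↦
      (rexp (-u * p.1) : ℂ) * stableKernel α p.1 (p.2 + (π / 2 : ℝ) * Complex.I))
      ((volume.restrict (Ioi 0)).prod volume) := by
  have h1 : IntegrableOn (fun s : ℝ ↦ rexp (-u * s)) (Ioi 0) :=
    integrableOn_exp_mul_Ioi (neg_lt_zero.2 hu) 0
  have h2 := (integrable_stableKernel_pi_div_two hα le_rfl).norm
  refine (h1.mul_prod h2).mono' ?_ (ae_of_all _ fun p ↦ ?_)
  · refine Continuous.aestronglyMeasurable ?_
    unfold stableKernel
    fun_prop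
  · rw [stableKernel_eq, exp_add_pi_div_two_mul_I, norm_mul, norm_mul, Complex.norm_real,
      norm_of_nonneg (exp_pos _).le, Complex.norm_exp]
    simp

theorem exp_mul_stableDensity_eq {α s : ℝ} (hα : α ∈ Ioo (0 : ℝ) 1) (hs : 0 < s) (u : ℝ) :
    rexp (-u * s) * stableDensity α s = (1 / π) * (∫ x : ℝ,
      (rexp (-u * s) : ℂ) * stableKernel α s (x + (π / 2 : ℝ) * Complex.I)).im := by
  rw [integral_const_mul, Complex.im_ofReal_mul, stableDensity_eq_im_integral hα hs]
  ring

theorem integrableOn_exp_mul_stableDensity {α u : ℝ} (hα : α ∈ Ioo (0 : ℝ) 1) (hu : 0 < u) :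
    IntegrableOn (fun s ↦ rexp (-u * s) * stableDensity α s) (Ioi 0) :=
  ((integrable_exp_mul_stableKernel hα hu).integral_prod_left.im.const_mul (1 / π)).congr <|
    (ae_restrict_iff' measurableSet_Ioi).2 <| ae_of_all _ fun _ hs ↦
      (exp_mul_stableDensity_eq hα hs u).symm

theorem integral_exp_mul_stableDensity {α u : ℝ} (hα : α ∈ Ioo (0 : ℝ) 1) (hu : 0 < u) :
    ∫ s in Ioi (0 : ℝ), rexp (-u * s) * stableDensity α s =
      (1 / π) * (∫ x : ℝ, stableKernel α 0 (x + (π / 2 : ℝ) * Complex.I) /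
        (u - rexp x * Complex.I)).im := by
  have hF := integrable_exp_mul_stableKernel hα hu
  have h1 : ∫ s in Ioi (0 : ℝ), ∫ x : ℝ,
      (rexp (-u * s) : ℂ) * stableKernel α s (x + (π / 2 : ℝ) * Complex.I) =
      ∫ x : ℝ, stableKernel α 0 (x + (π / 2 : ℝ) * Complex.I) / (u - rexp x * Complex.I) := by
    rw [integral_integral_swap hF]
    refine integral_congr_ae (ae_of_all _ fun x ↦ ?_)
    have h (s : ℝ) : (rexp (-u * s) : ℂ) * stableKernel α s (x + (π / 2 : ℝ) * Complex.I) =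
        Complex.exp ((-u + rexp x * Complex.I) * s) *
          stableKernel α 0 (x + (π / 2 : ℝ) * Complex.I) := by
      rw [stableKernel_eq α s, exp_add_pi_div_two_mul_I, ← mul_assoc, Complex.ofReal_exp,
        ← Complex.exp_add]
      push_cast
      ring_nf
    simp_rw [h]
    rw [integral_mul_const, integral_exp_mul_complex_Ioi (by simpa using hu)]
    rw [show (-(u : ℂ) + rexp x * Complex.I) = -(u - rexp x * Complex.I) by ring, neg_div_neg_eq]
    simp [div_eq_inv_mul]
  rw [← h1, setIntegral_congr_fun measurableSet_Ioi
    fun s hs ↦ exp_mul_stableDensity_eq hα hs u, integral_const_mul]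
  congr 1
  exact integral_im hF.integral_prod_left

theorem integrable_and_integral_exp_div_sq_add_sq {u : ℝ} (hu : 0 < u) :
    Integrable (fun x ↦ 2 * u * rexp x / (u ^ 2 + rexp x ^ 2)) ∧
      ∫ x, 2 * u * rexp x / (u ^ 2 + rexp x ^ 2) = π := by
  have hd (x : ℝ) : HasDerivAt (fun x ↦ 2 * arctan (rexp x / u))
      (2 * u * rexp x / (u ^ 2 + rexp x ^ 2)) x :=
    ((((hasDerivAt_exp x).div_const u).arctan).const_mul 2).congr_deriv (by field_simp)
  have hi : Integrable (fun x ↦ 2 * u * rexp x / (u ^ 2 + rexp x ^ 2)) := by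
    have h1 : Integrable fun v : ℝ ↦ (1 + (v / u) ^ 2)⁻¹ :=
      integrable_inv_one_add_sq.comp_div hu.ne'
    have h2 := (integrableOn_image_iff_integrableOn_abs_deriv_smul (s := univ) (f := rexp)
      MeasurableSet.univ (fun x _ ↦ (hasDerivAt_exp x).hasDerivWithinAt) exp_injective.injOn
      fun v : ℝ ↦ (1 + (v / u) ^ 2)⁻¹).1 h1.integrableOn
    rw [integrableOn_univ] at h2
    refine (h2.const_mul (2 / u)).congr (ae_of_all _ fun x ↦ ?_)
    simp only [abs_of_pos (exp_pos x), smul_eq_mul]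
    field_simp
  refine ⟨hi, ?_⟩
  have hbot : Tendsto (fun x ↦ 2 * arctan (rexp x / u)) atBot (𝓝 0) := by
    simpa using ((continuous_arctan.tendsto _).comp
      (tendsto_exp_atBot.div_const u)).const_mul 2
  have htop : Tendsto (fun x ↦ 2 * arctan (rexp x / u)) atTop (𝓝 π) := by
    have h := ((tendsto_arctan_atTop.mono_right nhdsWithin_le_nhds).comp
      (tendsto_exp_atTop.atTop_div_const hu)).const_mul 2
    rwa [mul_div_cancel₀ _ two_ne_zero] at h
  simpa using integral_of_hasDerivAt_of_tendsto hd hi hbot htop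

/-- The function `e^{-z^α}` minus the multiple of `2u / (u + z)` that makes it vanish at `z = u`. -/
noncomputable def expNegRpowSubPole (α u : ℝ) (z : ℂ) : ℂ :=
  Complex.exp (-z ^ (α : ℂ)) - rexp (-u ^ α) * (2 * u / (u + z))

theorem expNegRpowSubPole_self {α u : ℝ} (hu : 0 < u) : expNegRpowSubPole α u u = 0 := by
  have : (u : ℂ) ≠ 0 := by exact_mod_cast hu.ne'
  rw [expNegRpowSubPole, ← Complex.ofReal_cpow hu.le]
  push_cast
  field_simp
  ring

theorem differentiableOn_expNegRpowSubPole (α u : ℝ) :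
    DifferentiableOn ℂ (expNegRpowSubPole α u) (Complex.slitPlane ∩ {z | -u < z.re}) := by
  intro z hz
  have h1 : (u + z : ℂ) ≠ 0 := fun h ↦ by
    have := congrArg Complex.re h
    have := hz.2
    simp at *
    linarith
  have h2 : DifferentiableAt ℂ (fun z : ℂ ↦ z ^ (α : ℂ)) z :=
    differentiableAt_id.cpow_const hz.1
  unfold expNegRpowSubPole
  refine DifferentiableAt.differentiableWithinAt ?_
  fun_prop (disch := assumption)

theorem exp_mem_slitPlane_inter {u x y : ℝ} (hu : 0 < u) (hy : y ∈ Icc 0 (π / 2)) :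
    Complex.exp (x + y * Complex.I) ∈ Complex.slitPlane ∩ {z | -u < z.re} := by
  have hc : 0 ≤ cos y := cos_nonneg_of_mem_Icc ⟨by linarith [pi_pos, hy.1], hy.2⟩
  constructor
  · rw [Complex.mem_slitPlane_iff]
    rcases hy.1.eq_or_lt with rfl | h
    · left; simp [Complex.exp_re, exp_pos]
    · right
      have := sin_pos_of_pos_of_lt_pi h (by linarith [pi_pos, hy.2])
      simp [Complex.exp_im, this.ne']
  · have := mul_nonneg (exp_pos x).le hc
    simp [Complex.exp_re]
    linarith

theorem exp_cpow_of_mem_Icc {α x y : ℝ} (hy : y ∈ Icc 0 (π / 2)) :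
    Complex.exp (x + y * Complex.I) ^ (α : ℂ) = Complex.exp (α * (x + y * Complex.I)) := by
  rw [Complex.cpow_def_of_ne_zero (Complex.exp_ne_zero _), Complex.log_exp, mul_comm]
  · simp; linarith [hy.1, pi_pos]
  · simp; linarith [hy.2, pi_pos]

/-- The Cauchy kernel of `expNegRpowSubPole` at `u`, in the logarithmic coordinate `z = e^w`;
the singularity at `z = u` is removed. -/
noncomputable def cauchyKernel (α u : ℝ) (w : ℂ) : ℂ :=
  dslope (expNegRpowSubPole α u) u (Complex.exp w) * Complex.exp w

theorem cauchyKernel_of_ne {α u : ℝ} (hu : 0 < u) {w : ℂ} (hw : Complex.exp w ≠ u) :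
    cauchyKernel α u w =
      expNegRpowSubPole α u (Complex.exp w) / (Complex.exp w - u) * Complex.exp w := by
  rw [cauchyKernel, dslope_of_ne _ hw, slope_def_field, expNegRpowSubPole_self hu, sub_zero]

theorem differentiableOn_cauchyKernel {α u : ℝ} (hu : 0 < u) :
    DifferentiableOn ℂ (cauchyKernel α u) {w | w.im ∈ Icc 0 (π / 2)} := by
  have hopen : IsOpen (Complex.slitPlane ∩ {z | -u < z.re}) :=
    Complex.isOpen_slitPlane.inter (isOpen_lt continuous_const Complex.continuous_re)
  have hmem : (u : ℂ) ∈ Complex.slitPlane ∩ {z | -u < z.re} := by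
    simp [Complex.mem_slitPlane_iff, hu]
  have h := (Complex.differentiableOn_dslope (hopen.mem_nhds hmem)).2
    (differentiableOn_expNegRpowSubPole α u)
  refine (h.comp Complex.differentiable_exp.differentiableOn fun w hw ↦ ?_).mul
    Complex.differentiable_exp.differentiableOn
  rw [← Complex.re_add_im w]
  exact exp_mem_slitPlane_inter hu hw

theorem norm_cauchyKernel_le {α u x y m : ℝ} (hu : 0 < u) (hy : y ∈ Icc 0 (π / 2))
    (hm : 0 < m) (h : m ≤ |rexp x - u|) :
    ‖cauchyKernel α u (x + y * Complex.I)‖ ≤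
      (rexp (-(rexp (α * x) * cos (α * y))) + 2 * u / m) / m * rexp x := by
  set z := Complex.exp (x + y * Complex.I) with hz
  have hnorm : ‖z‖ = rexp x := by simp [hz, Complex.norm_exp]
  have h1 : m ≤ ‖z - u‖ := by
    refine h.trans ?_
    rw [← hnorm]
    simpa [abs_of_pos hu] using abs_norm_sub_norm_le z u
  have h2 : m ≤ ‖u + z‖ := by
    refine h.trans ?_
    rw [← hnorm]
    simpa [abs_of_pos hu, add_comm] using abs_norm_sub_norm_le z (-u)
  have hne : z ≠ u := fun hzu ↦ by simp [hzu] at h1; linarith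
  have hE : rexp (-u ^ α) ≤ 1 := exp_le_one_iff.2 (neg_nonpos.2 (rpow_nonneg hu.le α))
  rw [cauchyKernel_of_ne hu hne, norm_mul, norm_div, ← hz, hnorm]
  gcongr
  rw [expNegRpowSubPole]
  refine (norm_sub_le _ _).trans ?_
  rw [hz, exp_cpow_of_mem_Icc hy, norm_exp_neg_exp_mul, ← hz, norm_mul, norm_div,
    Complex.norm_real, norm_of_nonneg (exp_pos _).le]
  have : ‖(2 * u : ℂ)‖ = 2 * u := by simp [abs_of_pos hu]
  rw [this]
  gcongr
  calc rexp (-u ^ α) * (2 * u / ‖u + z‖) ≤ 1 * (2 * u / m) := by gcongr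
    _ = 2 * u / m := one_mul _

theorem cos_mul_ge {α y : ℝ} (hα : α ∈ Ioo (0 : ℝ) 1) (hy : y ∈ Icc 0 (π / 2)) :
    cos (α * (π / 2)) ≤ cos (α * y) := by
  apply cos_le_cos_of_nonneg_of_le_pi (mul_nonneg hα.1.le hy.1)
  · nlinarith [pi_pos, hα.2]
  · exact mul_le_mul_of_nonneg_left hy.2 hα.1.le

theorem cos_mul_pi_div_two_pos {α : ℝ} (hα : α ∈ Ioo (0 : ℝ) 1) : 0 < cos (α * (π / 2)) :=
  cos_pos_of_mem_Ioo ⟨by nlinarith [pi_pos, hα.1], by nlinarith [pi_pos, hα.2]⟩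

theorem eventually_atTop_norm_cauchyKernel_le {α u : ℝ} (hα : α ∈ Ioo (0 : ℝ) 1) (hu : 0 < u) :
    ∀ᶠ x : ℝ in atTop, ∀ y ∈ Icc 0 (π / 2),
      ‖cauchyKernel α u (x + y * Complex.I)‖ ≤ (2 + 8 * u + 10 / u) * rexp (-1 * x) := by
  filter_upwards [eventually_mul_le_exp hα.1 (cos_mul_pi_div_two_pos hα) 1,
    tendsto_exp_atTop.eventually_ge_atTop (2 * u)] with x h1 h2 y hy
  have h3 : rexp (-(rexp (α * x) * cos (α * y))) ≤ rexp (-x) := by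
    rw [exp_le_exp]
    have := mul_le_mul_of_nonneg_left (cos_mul_ge hα hy) (exp_pos (α * x)).le
    linarith
  refine (norm_cauchyKernel_le hu hy (m := rexp x / 2) (by positivity) ?_).trans ?_
  · exact le_trans (by linarith) (le_abs_self _)
  · calc _ ≤ (rexp (-x) + 2 * u / (rexp x / 2)) / (rexp x / 2) * rexp x := by gcongr
      _ = (2 + 8 * u) * rexp (-1 * x) := by
        rw [neg_one_mul, exp_neg]; field_simp; ring
      _ ≤ _ := by gcongr ?_ * _; exact le_add_of_nonneg_right (by positivity)

theorem eventually_atBot_norm_cauchyKernel_le {α u : ℝ} (hα : α ∈ Ioo (0 : ℝ) 1) (hu : 0 < u) :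
    ∀ᶠ x : ℝ in atBot, ∀ y ∈ Icc 0 (π / 2),
      ‖cauchyKernel α u (x + y * Complex.I)‖ ≤ (2 + 8 * u + 10 / u) * rexp (1 * x) := by
  filter_upwards [tendsto_exp_atBot.eventually_le_const (half_pos hu)] with x h2 y hy
  have h3 : rexp (-(rexp (α * x) * cos (α * y))) ≤ 1 := by
    rw [exp_le_one_iff, neg_nonpos]
    exact mul_nonneg (exp_pos _).le ((cos_mul_pi_div_two_pos hα).le.trans (cos_mul_ge hα hy))
  refine (norm_cauchyKernel_le hu hy (m := u / 2) (by positivity) ?_).trans ?_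
  · exact le_trans (by linarith) (neg_le_abs _)
  · calc _ ≤ (1 + 2 * u / (u / 2)) / (u / 2) * rexp x := by gcongr
      _ = 10 / u * rexp (1 * x) := by rw [one_mul]; field_simp; ring
      _ ≤ _ := by gcongr; linarith

theorem im_integral_cauchyKernel {α u : ℝ} (hα : α ∈ Ioo (0 : ℝ) 1) (hu : 0 < u) :
    (∫ x : ℝ, cauchyKernel α u (x + (π / 2 : ℝ) * Complex.I)).im = 0 := by
  have h0 : (0 : ℝ) ≤ π / 2 := by positivity
  have hd := differentiableOn_cauchyKernel (α := α) hu
  have htop := eventually_atTop_norm_cauchyKernel_le hα hu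
  have hbot := eventually_atBot_norm_cauchyKernel_le hα hu
  have hi := integrable_line_of_decay one_pos hd htop hbot (left_mem_Icc.2 h0)
  rw [← integral_line_eq_of_decay h0 one_pos hd htop hbot]
  refine (integral_im hi).symm.trans (integral_eq_zero_of_ae ?_)
  filter_upwards [Measure.ae_ne volume (log u)] with x hx
  have hexp : Complex.exp (x + (0 : ℝ) * Complex.I) = (rexp x : ℝ) := by simp
  have hne : Complex.exp (x + (0 : ℝ) * Complex.I) ≠ u := by
    rw [hexp]
    exact_mod_cast fun h ↦ hx (by rw [← h, log_exp])
  rw [cauchyKernel_of_ne hu hne, hexp, expNegRpowSubPole, ← Complex.ofReal_cpow (exp_pos x).le]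
  norm_cast

theorem im_integral_stableKernel_div {α u : ℝ} (hα : α ∈ Ioo (0 : ℝ) 1) (hu : 0 < u) :
    (∫ x : ℝ, stableKernel α 0 (x + (π / 2 : ℝ) * Complex.I) /
      (u - rexp x * Complex.I)).im = π * rexp (-u ^ α) := by
  have h0 : (0 : ℝ) ≤ π / 2 := by positivity
  have hi := integrable_line_of_decay one_pos (differentiableOn_cauchyKernel (α := α) hu)
    (eventually_atTop_norm_cauchyKernel_le hα hu) (eventually_atBot_norm_cauchyKernel_le hα hu)
    (right_mem_Icc.2 h0)
  obtain ⟨hJ, hJπ⟩ := integrable_and_integral_exp_div_sq_add_sq hu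
  have hJ' : Integrable fun x ↦ ((2 * u * rexp x / (u ^ 2 + rexp x ^ 2) : ℝ) : ℂ) := hJ.ofReal
  have key (x : ℝ) : stableKernel α 0 (x + (π / 2 : ℝ) * Complex.I) / (u - rexp x * Complex.I) =
      rexp (-u ^ α) * Complex.I * ((2 * u * rexp x / (u ^ 2 + rexp x ^ 2) : ℝ) : ℂ) -
        cauchyKernel α u (x + (π / 2 : ℝ) * Complex.I) := by
    have h1 : (rexp x * Complex.I : ℂ) ≠ u := fun h ↦ by
      simpa [hu.ne] using congrArg Complex.re h
    have h2 : (u + rexp x * Complex.I : ℂ) ≠ 0 := fun h ↦ by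
      simpa [hu.ne'] using congrArg Complex.re h
    have h3 : (u ^ 2 + rexp x ^ 2 : ℂ) ≠ 0 := by
      exact_mod_cast (by positivity : u ^ 2 + rexp x ^ 2 ≠ 0)
    have h4 : (rexp x * Complex.I - u : ℂ) ≠ 0 := sub_ne_zero.2 h1
    have h5 : (u ^ 2 + rexp x ^ 2 : ℂ) =
        -((u + rexp x * Complex.I) * (rexp x * Complex.I - u)) := by
      ring_nf; rw [Complex.I_sq]; ring
    have h6 := exp_cpow_of_mem_Icc (α := α) (x := x) (right_mem_Icc.2 h0)
    rw [exp_add_pi_div_two_mul_I] at h6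
    rw [cauchyKernel_of_ne hu (by rwa [exp_add_pi_div_two_mul_I]), stableKernel,
      exp_add_pi_div_two_mul_I, expNegRpowSubPole, h6]
    rw [← neg_sub (rexp x * Complex.I : ℂ) u]
    simp only [Complex.ofReal_div, Complex.ofReal_add, Complex.ofReal_pow, Complex.ofReal_mul,
      Complex.ofReal_ofNat, h5, Complex.ofReal_zero, zero_mul, Complex.exp_zero]
    field_simp
    ring
  simp_rw [key]
  rw [integral_sub (hJ'.const_mul _) hi, integral_const_mul, Complex.sub_im,
    im_integral_cauchyKernel hα hu, integral_complex_ofReal, hJπ, mul_right_comm,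
    ← Complex.ofReal_mul, Complex.mul_I_im, Complex.ofReal_re, sub_zero, mul_comm]

theorem integrableOn_Ioi_one_stableDensity {α : ℝ} (hα : α ∈ Ioo (0 : ℝ) 1) :
    IntegrableOn (stableDensity α) (Ioi 1) := by
  have hbound : Integrable fun x : ℝ ↦ rexp (-rexp x + rexp (α * x) + α * x) := by
    refine (by fun_prop : Continuous fun x : ℝ ↦
      rexp (-rexp x + rexp (α * x) + α * x)).locallyIntegrable.integrable_of_isBigO_atBot_atTop
        (g := fun x ↦ rexp (α * x)) (g' := fun x ↦ rexp (-1 * x)) ?_ ?_ ?_ ?_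
    · refine Asymptotics.IsBigO.of_bound (rexp 1) ?_
      filter_upwards [eventually_le_atBot 0] with x hx
      rw [norm_of_nonneg (exp_pos _).le, norm_of_nonneg (exp_pos _).le, ← exp_add, exp_le_exp]
      have : rexp (α * x) ≤ 1 := exp_le_one_iff.2 (mul_nonpos_of_nonneg_of_nonpos hα.1.le hx)
      linarith [exp_pos x]
    · exact ⟨Iic 0, Iic_mem_atBot 0, integrableOn_exp_mul_Iic hα.1 0⟩
    · refine Asymptotics.IsBigO.of_bound 1 ?_
      filter_upwards [eventually_mul_add_exp_le hα.2 one_pos (α + 1) 1] with x hx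
      rw [norm_of_nonneg (exp_pos _).le, norm_of_nonneg (exp_pos _).le, one_mul, exp_le_exp]
      linarith
    · exact ⟨Ioi 0, Ioi_mem_atTop 0, integrableOn_exp_mul_Ioi (by norm_num) 0⟩
  have hdom : Integrable (fun p : ℝ × ℝ ↦
      rexp (-rexp p.2 * p.1) * rexp (p.2 + rexp (α * p.2) + α * p.2))
      ((volume.restrict (Ioi 1)).prod volume) := by
    rw [integrable_prod_iff' (Continuous.aestronglyMeasurable (by fun_prop))]
    refine ⟨ae_of_all _ fun x ↦
      Integrable.mul_const
        (integrableOn_exp_mul_Ioi (neg_lt_zero.2 (exp_pos x)) 1) (rexp (x + rexp (α * x) + α * x)), ?_⟩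
    refine hbound.congr (ae_of_all _ fun x ↦ ?_)
    simp only [norm_mul, norm_of_nonneg (exp_pos _).le]
    rw [integral_mul_const, integral_exp_mul_Ioi (neg_lt_zero.2 (exp_pos x))]
    rw [neg_div_neg_eq, mul_one, ← exp_sub, ← exp_add]
    ring_nf
  have hint : Integrable (fun p : ℝ × ℝ ↦ (stableKernel α p.1 (p.2 + π * Complex.I)).im)
      ((volume.restrict (Ioi 1)).prod volume) := by
    refine hdom.mono' (Continuous.aestronglyMeasurable (by unfold stableKernel; fun_prop))
      (ae_of_all _ fun ⟨s, x⟩ ↦ ?_)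
    have h1 : |sin (rexp (α * x) * sin (π * α))| ≤ rexp (α * x) := by
      refine abs_sin_le_abs.trans ?_
      rw [abs_mul, abs_of_pos (exp_pos _)]
      exact mul_le_of_le_one_right (exp_pos _).le (abs_sin_le_one _)
    have h2 : rexp (-(rexp (α * x)) * cos (π * α)) ≤ rexp (rexp (α * x)) := by
      rw [exp_le_exp]
      nlinarith [neg_one_le_cos (π * α), exp_pos (α * x)]
    simp only [im_stableKernel_pi, norm_mul, norm_of_nonneg (exp_pos _).le, Real.norm_eq_abs]
    calc _ ≤ rexp x * (rexp (-s * rexp x) * rexp (rexp (α * x)) * rexp (α * x)) := by gcongr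
      _ = _ := by simp only [← exp_add]; ring_nf
  refine (hint.integral_prod_left.const_mul (1 / π)).congr (ae_of_all _ fun s ↦ ?_)
  exact (stableDensity_eq_integral_real α s).symm

theorem integrableOn_stableDensity {α : ℝ} (hα : α ∈ Ioo (0 : ℝ) 1) :
    IntegrableOn (stableDensity α) (Ioi 0) := by
  rw [← Ioc_union_Ioi_eq_Ioi zero_le_one]
  refine IntegrableOn.union ?_ (integrableOn_Ioi_one_stableDensity hα)
  have h : IntegrableOn (fun s ↦ rexp (-1 * s) * stableDensity α s) (Ioc 0 1) :=
    (integrableOn_exp_mul_stableDensity hα one_pos).mono_set Ioc_subset_Ioi_self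
  refine (Integrable.bdd_mul (c := rexp 1) h continuous_exp.aestronglyMeasurable ?_).congr ?_
  · filter_upwards [ae_restrict_mem measurableSet_Ioc] with s hs
    rw [norm_of_nonneg (exp_pos _).le, exp_le_exp]
    exact hs.2
  · refine ae_of_all _ fun s ↦ ?_
    simp only [← mul_assoc, ← exp_add]
    simp

theorem pollard_formula_of_pos {α u : ℝ} (hα : α ∈ Ioo (0 : ℝ) 1) (hu : 0 < u) :
    rexp (-(u ^ α)) = ∫ s in Ioi (0 : ℝ), rexp (-u * s) * stableDensity α s := by
  rw [integral_exp_mul_stableDensity hα hu, im_integral_stableKernel_div hα hu]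
  field_simp

/-- Pollard's formula: `e^{-u^α} = ∫_0^∞ e^{-us} g(α,s) ds` for `u ≥ 0`, `α ∈ (0,1)`. -/
theorem pollard_formula (α : ℝ) (hα : α ∈ Ioo (0 : ℝ) 1) (u : ℝ) (hu : 0 ≤ u) :
    Real.exp (-(u ^ α)) = ∫ s in Ioi (0 : ℝ), Real.exp (-u * s) * stableDensity α s := by
  rcases hu.lt_or_eq with hu | rfl
  · exact pollard_formula_of_pos hα hu
  have hg := integrableOn_stableDensity hα
  have h1 : Tendsto (fun u : ℝ ↦ rexp (-(u ^ α))) (𝓝[>] 0) (𝓝 (rexp (-(0 ^ α)))) :=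
    ((continuous_exp.comp (continuous_id.rpow_const
      fun _ ↦ Or.inr hα.1.le).neg).tendsto 0).mono_left nhdsWithin_le_nhds
  have h2 : Tendsto (fun u : ℝ ↦ ∫ s in Ioi (0 : ℝ), rexp (-u * s) * stableDensity α s)
      (𝓝[>] 0) (𝓝 (∫ s in Ioi (0 : ℝ), rexp (-0 * s) * stableDensity α s)) := by
    refine tendsto_integral_filter_of_dominated_convergence (fun s ↦ ‖stableDensity α s‖)
      ?_ ?_ hg.norm ?_
    · exact Eventually.of_forall fun u ↦
        (by fun_prop : Continuous fun s ↦ rexp (-u * s)).aestronglyMeasurable.mul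
          hg.aestronglyMeasurable
    · filter_upwards [self_mem_nhdsWithin] with u hu
      filter_upwards [ae_restrict_mem measurableSet_Ioi] with s hs
      rw [norm_mul, norm_of_nonneg (exp_pos _).le]
      refine mul_le_of_le_one_left (norm_nonneg _) (exp_le_one_iff.2 ?_)
      rw [neg_mul, neg_nonpos]
      exact (mul_pos hu hs).le
    · exact ae_of_all _ fun s ↦ (((by fun_prop : Continuous fun u ↦
        rexp (-u * s) * stableDensity α s).tendsto 0).mono_left nhdsWithin_le_nhds)
  refine tendsto_nhds_unique h1 (h2.congr' ?_)
  filter_upwards [self_mem_nhdsWithin] with u hu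
  exact (pollard_formula_of_pos hα hu).symm
end

section
/- The function g(α,s) = (1/π) ∫_0^∞ e^{-sv} e^{-v^α cos(πα)} sin(v^α sin(πα)) dv is nonnegative on [0,∞) and satisfies ∫_0^∞ g(α,s) ds = 1; i.e., g(α,·) is a probability density. -/
open MeasureTheory Real Set

open Filter Topology

/-- The entire function `w ↦ exp (s e^w - e^{αw})`, i.e. `z ↦ exp (s z - z ^ α)` in the
logarithmic coordinate `w = log z`. -/
noncomputable def laplaceKernel (α s : ℝ) (w : ℂ) : ℂ :=
  Complex.exp (s * Complex.exp w - Complex.exp (α * w))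

lemma laplaceKernel_exponent (α s x φ : ℝ) :
    (s * Complex.exp (x + φ * Complex.I) - Complex.exp (α * (x + φ * Complex.I)) : ℂ) =
      ((s * exp x * cos φ - exp (α * x) * cos (α * φ) : ℝ) : ℂ) +
      ((s * exp x * sin φ - exp (α * x) * sin (α * φ) : ℝ) : ℂ) * Complex.I := by
  have h : (α * (x + φ * Complex.I) : ℂ) = ((α * x : ℝ) : ℂ) + ((α * φ : ℝ) : ℂ) * Complex.I := by
    push_cast; ring
  rw [h, Complex.exp_add_mul_I, Complex.exp_add_mul_I]
  push_cast
  ring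

lemma norm_laplaceKernel (α s x φ : ℝ) :
    ‖laplaceKernel α s (x + φ * Complex.I)‖ =
      exp (s * exp x * cos φ - exp (α * x) * cos (α * φ)) := by
  rw [laplaceKernel, laplaceKernel_exponent, Complex.norm_exp, Complex.add_re, Complex.re_ofReal_mul, Complex.I_re, mul_zero, add_zero, Complex.ofReal_re]

lemma laplaceKernel_im (α s x φ : ℝ) :
    (laplaceKernel α s (x + φ * Complex.I)).im =
      exp (s * exp x * cos φ - exp (α * x) * cos (α * φ)) *
        sin (s * exp x * sin φ - exp (α * x) * sin (α * φ)) := by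
  rw [laplaceKernel, laplaceKernel_exponent, Complex.exp_im, Complex.add_re, Complex.re_ofReal_mul,
    Complex.add_im, Complex.im_ofReal_mul, Complex.I_re, Complex.I_im, Complex.ofReal_re,
    Complex.ofReal_im, mul_zero, add_zero, mul_one, zero_add]

lemma exists_primitive_laplaceKernel (α s : ℝ) :
    ∃ K : ℂ → ℂ, (∀ w, HasDerivAt K (laplaceKernel α s w) w) ∧ K 0 = 0 := by
  have hd : Differentiable ℂ (laplaceKernel α s) := by
    unfold laplaceKernel; fun_prop
  obtain ⟨K, hK⟩ := hd.isExactOn_univ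
  exact ⟨fun w => K w - K 0, fun w => (hK w (mem_univ w)).sub_const _, by simp⟩

lemma primitive_ofReal_im {α s : ℝ} {K : ℂ → ℂ}
    (hK : ∀ w, HasDerivAt K (laplaceKernel α s w) w) (h0 : K 0 = 0) (x : ℝ) :
    (K x).im = 0 := by
  have hd : ∀ y : ℝ, HasDerivAt (fun t : ℝ => (K t).im) 0 y := fun y => by
    have h1 : HasDerivAt (fun t : ℝ => K t) (laplaceKernel α s y) y := (hK y).comp_ofReal
    have h2 : (laplaceKernel α s y).im = 0 := by
      simpa using laplaceKernel_im α s y 0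
    simpa [h2] using! (Complex.imCLM.hasFDerivAt.comp_hasDerivAt y h1)
  have := is_const_of_deriv_eq_zero (fun y => (hd y).differentiableAt)
    (fun y => (hd y).deriv) x 0
  simpa [h0] using this

lemma hasDerivAt_primitive_vertical {α s : ℝ} {K : ℂ → ℂ}
    (hK : ∀ w, HasDerivAt K (laplaceKernel α s w) w) (x φ : ℝ) :
    HasDerivAt (fun t : ℝ => K (x + t * Complex.I))
      (laplaceKernel α s (x + φ * Complex.I) * Complex.I) φ := by
  have h1 : HasDerivAt (fun t : ℝ => (x + t * Complex.I : ℂ)) Complex.I φ := by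
    simpa using ((Complex.ofRealCLM.hasDerivAt (x := φ)).mul_const Complex.I).const_add (x : ℂ)
  exact (hK _).comp φ h1

lemma norm_primitive_vertical_sub_le {α s : ℝ} {K : ℂ → ℂ}
    (hK : ∀ w, HasDerivAt K (laplaceKernel α s w) w) {x a b C : ℝ} (hab : a ≤ b)
    (hC : ∀ φ ∈ Icc a b, ‖laplaceKernel α s (x + φ * Complex.I)‖ ≤ C) :
    ‖K (x + b * Complex.I) - K (x + a * Complex.I)‖ ≤ C * (b - a) := by
  refine norm_image_sub_le_of_norm_deriv_le_segment' (f := fun t : ℝ => K (x + t * Complex.I))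
    (fun φ _ => (hasDerivAt_primitive_vertical hK x φ).hasDerivWithinAt) (fun φ hφ => ?_) b
    (right_mem_Icc.2 hab)
  simpa using hC φ (Ico_subset_Icc_self hφ)

lemma tendsto_primitive_im_atBot {α s : ℝ} (hα : 0 < α) {K : ℂ → ℂ}
    (hK : ∀ w, HasDerivAt K (laplaceKernel α s w) w) (h0 : K 0 = 0) :
    Tendsto (fun x : ℝ => (K (x + π * Complex.I)).im) atBot (𝓝 π) := by
  set u : ℝ → ℝ := fun x => |s| * exp x + exp (α * x) with hu
  have hu0 : Tendsto u atBot (𝓝 0) := by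
    have h1 : Tendsto (fun x : ℝ => α * x) atBot atBot := tendsto_id.const_mul_atBot hα
    simpa using (tendsto_exp_atBot.const_mul |s|).add (tendsto_exp_atBot.comp h1)
  have hkey : ∀ᶠ x : ℝ in atBot, ‖(K (x + π * Complex.I)).im - π‖ ≤ 2 * u x * π := by
    filter_upwards [hu0.eventually (ge_mem_nhds one_pos)] with x hx
    have h1 : ∀ φ : ℝ, ‖laplaceKernel α s (x + φ * Complex.I) - 1‖ ≤ 2 * u x := fun φ => by
      have hn : ‖(s * Complex.exp (x + φ * Complex.I) -
          Complex.exp (α * (x + φ * Complex.I)) : ℂ)‖ ≤ u x := by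
        refine (norm_sub_le _ _).trans_eq ?_
        simp [Complex.norm_exp, hu]
      exact (Complex.norm_exp_sub_one_le (hn.trans hx)).trans (by linarith)
    have h2 := norm_image_sub_le_of_norm_deriv_le_segment' (a := 0) (b := π) (C := 2 * u x)
      (f := fun t : ℝ => K (x + t * Complex.I) - t * Complex.I)
      (f' := fun t : ℝ => laplaceKernel α s (x + t * Complex.I) * Complex.I - Complex.I)
      (fun φ _ => by
        have h3 : HasDerivAt (fun t : ℝ => (t * Complex.I : ℂ)) Complex.I φ := by
          simpa using (Complex.ofRealCLM.hasDerivAt (x := φ)).mul_const Complex.I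
        exact ((hasDerivAt_primitive_vertical hK x φ).sub h3).hasDerivWithinAt)
      (fun φ _ => by
        rw [← sub_one_mul, norm_mul, Complex.norm_I, mul_one]
        exact h1 φ) π (right_mem_Icc.2 pi_pos.le)
    have h4 := (Complex.abs_im_le_norm _).trans h2
    simpa [primitive_ofReal_im hK h0] using h4
  rw [tendsto_iff_norm_sub_tendsto_zero]
  refine squeeze_zero' (Eventually.of_forall fun _ => norm_nonneg _) hkey ?_
  simpa using (hu0.const_mul 2).mul_const π

lemma exists_rpow_le_mul_add {α c : ℝ} (hα : α ∈ Ioo (0 : ℝ) 1) (hc : 0 < c) :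
    ∃ C, ∀ v : ℝ, 0 ≤ v → v ^ α ≤ c * v + C := by
  have h := (tendsto_rpow_neg_atTop (sub_pos.2 hα.2)).eventually (ge_mem_nhds hc)
  obtain ⟨M, hM⟩ := eventually_atTop.1 h
  refine ⟨(max M 0) ^ α, fun v hv => ?_⟩
  rcases le_total (max M 0) v with h1 | h1
  · have h2 := rpow_nonneg (le_max_right M 0) α
    rcases hv.eq_or_lt with rfl | hv
    · simpa [zero_rpow hα.1.ne'] using h2
    have h3 := mul_le_mul_of_nonneg_right (hM v ((le_max_left _ _).trans h1)) hv.le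
    rw [← rpow_add_one hv.ne', show -(1 - α) + 1 = α by ring] at h3
    linarith
  · have := rpow_le_rpow hv h1 hα.1.le
    have := mul_nonneg hc.le hv
    linarith

/-- Logarithm of the radius at angle `θ` of the curve on which `s z - z ^ α` is real. -/
noncomputable def realCurveLog (α s θ : ℝ) : ℝ :=
  (log (sin (α * θ)) - log (sin θ) - log s) / (1 - α)

/-- The value of `z ^ α - s z` on the curve where it is real, at angle `θ`. -/
noncomputable def realCurveExponent (α s θ : ℝ) : ℝ :=
  exp ((log (sin (α * θ)) - log (sin θ) - α * log s) / (1 - α)) *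
    (sin ((1 - α) * θ) / sin (α * θ))

lemma sin_mul_pos {c θ : ℝ} (hc : c ∈ Ioo (0 : ℝ) 1) (hθ : θ ∈ Ioo 0 π) : 0 < sin (c * θ) :=
  sin_pos_of_pos_of_lt_pi (mul_pos hc.1 hθ.1)
    ((mul_lt_of_lt_one_left hθ.1 hc.2).trans hθ.2)

lemma one_sub_mem_Ioo {α : ℝ} (hα : α ∈ Ioo (0 : ℝ) 1) : 1 - α ∈ Ioo (0 : ℝ) 1 :=
  ⟨sub_pos.2 hα.2, sub_lt_self _ hα.1⟩

lemma realCurveExponent_pos {α s θ : ℝ} (hα : α ∈ Ioo (0 : ℝ) 1) (hθ : θ ∈ Ioo 0 π) :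
    0 < realCurveExponent α s θ :=
  mul_pos (exp_pos _) (div_pos (sin_mul_pos (one_sub_mem_Ioo hα) hθ) (sin_mul_pos hα hθ))

lemma laplaceKernel_realCurve {α s θ : ℝ} (hα : α ∈ Ioo (0 : ℝ) 1) (hs : 0 < s)
    (hθ : θ ∈ Ioo 0 π) :
    laplaceKernel α s (realCurveLog α s θ + θ * Complex.I) =
      (exp (-realCurveExponent α s θ) : ℝ) := by
  have hsα := sin_mul_pos hα hθ
  have hsθ := sin_pos_of_pos_of_lt_pi hθ.1 hθ.2
  have h1α : (1 - α) ≠ 0 := (sub_pos.2 hα.2).ne'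
  set x := realCurveLog α s θ with hx
  have hlog : log s + x + log (sin θ) = α * x + log (sin (α * θ)) := by
    have : (1 - α) * x = log (sin (α * θ)) - log (sin θ) - log s := by
      rw [hx, realCurveLog, mul_div_cancel₀ _ h1α]
    linarith
  have him : s * exp x * sin θ = exp (α * x) * sin (α * θ) := by
    have := congrArg exp hlog
    rwa [exp_add, exp_add, exp_add, exp_log hs, exp_log hsα, exp_log hsθ] at this
  have hW : realCurveExponent α s θ * sin (α * θ) = s * exp x * sin ((1 - α) * θ) := by
    have : (log (sin (α * θ)) - log (sin θ) - α * log s) / (1 - α) = log s + x := by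
      rw [hx, realCurveLog]; field_simp; ring
    rw [realCurveExponent, this, exp_add, exp_log hs]
    field_simp
  have hre : s * exp x * cos θ - exp (α * x) * cos (α * θ) = -realCurveExponent α s θ := by
    have h2 : sin ((1 - α) * θ) = sin θ * cos (α * θ) - cos θ * sin (α * θ) := by
      rw [← sin_sub]; ring_nf
    apply mul_right_cancel₀ hsα.ne'
    rw [neg_mul, hW, h2]
    linear_combination cos (α * θ) * him
  rw [laplaceKernel, laplaceKernel_exponent, hre, him]
  simp

lemma differentiableAt_realCurveLog {α s θ : ℝ} (hα : α ∈ Ioo (0 : ℝ) 1) (hθ : θ ∈ Ioo 0 π) :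
    DifferentiableAt ℝ (realCurveLog α s) θ := by
  have hsα := (sin_mul_pos hα hθ).ne'
  have hsθ := (sin_pos_of_pos_of_lt_pi hθ.1 hθ.2).ne'
  unfold realCurveLog
  fun_prop (disch := assumption)

lemma hasDerivAt_primitive_im_realCurve {α s θ : ℝ} (hα : α ∈ Ioo (0 : ℝ) 1) (hs : 0 < s)
    {K : ℂ → ℂ} (hK : ∀ w, HasDerivAt K (laplaceKernel α s w) w) (hθ : θ ∈ Ioo 0 π) :
    HasDerivAt (fun t : ℝ => (K (realCurveLog α s t + t * Complex.I)).im)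
      (exp (-realCurveExponent α s θ)) θ := by
  have h1 := (differentiableAt_realCurveLog (s := s) hα hθ).hasDerivAt.ofReal_comp
  have h2 : HasDerivAt (fun t : ℝ => (t * Complex.I : ℂ)) Complex.I θ := by
    simpa using (Complex.ofRealCLM.hasDerivAt (x := θ)).mul_const Complex.I
  have h3 := (hK _).comp θ (h1.add h2)
  have h4 := Complex.imCLM.hasFDerivAt.comp_hasDerivAt θ h3
  rw [Pi.add_apply, laplaceKernel_realCurve hα hs hθ] at h4
  exact h4.congr_deriv (by rw [Complex.imCLM_apply, Complex.im_ofReal_mul]; simp)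

lemma exp_realCurveLog_le {α s θ : ℝ} (hα : α ∈ Ioo (0 : ℝ) 1)
    (hθ : θ ∈ Ioc 0 (π / 2)) :
    exp (realCurveLog α s θ) ≤ exp ((log (π / 2) - log s) / (1 - α)) := by
  have hθ' : θ ∈ Ioo 0 π := ⟨hθ.1, hθ.2.trans_lt (half_lt_self pi_pos)⟩
  have hsα := sin_mul_pos hα hθ'
  have hsθ := sin_pos_of_pos_of_lt_pi hθ'.1 hθ'.2
  have h1 : sin (α * θ) ≤ π / 2 * sin θ := by
    have h2 := sin_le (mul_pos hα.1 hθ.1).le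
    have h3 := mul_le_sin hθ.1.le hθ.2
    have h4 : α * θ ≤ θ := mul_le_of_le_one_left hθ.1.le hα.2.le
    calc sin (α * θ) ≤ θ := h2.trans h4
      _ = π / 2 * (2 / π * θ) := by field_simp
      _ ≤ _ := by gcongr
  have h5 := log_le_log hsα h1
  rw [log_mul (by positivity) hsθ.ne'] at h5
  have := sub_pos.2 hα.2
  unfold realCurveLog
  gcongr
  linarith

lemma tendsto_primitive_im_realCurve_zero {α s : ℝ} (hα : α ∈ Ioo (0 : ℝ) 1) (hs : 0 < s)
    {K : ℂ → ℂ} (hK : ∀ w, HasDerivAt K (laplaceKernel α s w) w) (h0 : K 0 = 0) :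
    Tendsto (fun t : ℝ => (K (realCurveLog α s t + t * Complex.I)).im) (𝓝[>] 0) (𝓝 0) := by
  set C := exp (s * exp ((log (π / 2) - log s) / (1 - α))) with hC
  refine squeeze_zero_norm' (a := fun t => C * t) ?_ ?_
  · filter_upwards [Ioc_mem_nhdsGT (half_pos pi_pos)] with t ht
    have hx := exp_realCurveLog_le (s := s) hα ht
    set x := realCurveLog α s t
    have h1 := norm_primitive_vertical_sub_le hK (x := x) (C := C) ht.1.le fun φ hφ => by
      rw [norm_laplaceKernel, hC, exp_le_exp]
      have hφ2 : φ ≤ π / 2 := hφ.2.trans ht.2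
      have hαφ : α * φ ≤ φ := mul_le_of_le_one_left hφ.1 hα.2.le
      have h2 : 0 ≤ cos (α * φ) := cos_nonneg_of_neg_pi_div_two_le_of_le
        (by have := mul_nonneg hα.1.le hφ.1; linarith [pi_pos]) (by linarith)
      have h3 : s * exp x * cos φ ≤ s * exp x * 1 := by gcongr; exact cos_le_one _
      have h4 : s * exp x ≤ s * exp ((log (π / 2) - log s) / (1 - α)) := by gcongr
      have := mul_nonneg (exp_pos (α * x)).le h2
      linarith
    have h2 := (Complex.abs_im_le_norm _).trans h1
    simpa [primitive_ofReal_im hK h0] using h2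
  · have : Tendsto (fun t : ℝ => C * t) (𝓝 0) (𝓝 (C * 0)) := tendsto_id.const_mul C
    rw [mul_zero] at this
    exact this.mono_left nhdsWithin_le_nhds

lemma tendsto_realCurveLog_pi {α s : ℝ} (hα : α ∈ Ioo (0 : ℝ) 1) :
    Tendsto (realCurveLog α s) (𝓝[<] π) atTop := by
  have h1 : Tendsto (fun θ => log (sin θ)) (𝓝[<] π) atBot := by
    refine tendsto_log_nhdsGT_zero.comp (tendsto_nhdsWithin_iff.2 ⟨?_, ?_⟩)
    · have := continuous_sin.tendsto π
      rw [sin_pi] at this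
      exact this.mono_left nhdsWithin_le_nhds
    · filter_upwards [Ioo_mem_nhdsLT pi_pos] with θ hθ
      exact sin_pos_of_pos_of_lt_pi hθ.1 hθ.2
  have h2 : Tendsto (fun θ => log (sin (α * θ))) (𝓝[<] π) (𝓝 (log (sin (α * π)))) := by
    have hpos : 0 < sin (α * π) := sin_pos_of_pos_of_lt_pi (mul_pos hα.1 pi_pos)
      (mul_lt_of_lt_one_left pi_pos hα.2)
    have : ContinuousAt (fun θ => log (sin (α * θ))) π := by
      have := hpos.ne'
      fun_prop (disch := assumption)
    exact this.tendsto.mono_left nhdsWithin_le_nhds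
  have h3 := (h2.add_atTop (tendsto_neg_atBot_atTop.comp h1)).atTop_add
    (tendsto_const_nhds (x := -log s))
  refine (h3.atTop_div_const (sub_pos.2 hα.2)).congr fun θ => ?_
  simp [realCurveLog, sub_eq_add_neg]

lemma tendsto_primitive_im_realCurve_pi {α s : ℝ} (hα : α ∈ Ioo (0 : ℝ) 1) (hs : 0 < s)
    {K : ℂ → ℂ} (hK : ∀ w, HasDerivAt K (laplaceKernel α s w) w) :
    Tendsto (fun t : ℝ => (K (realCurveLog α s t + π * Complex.I)).im -
      (K (realCurveLog α s t + t * Complex.I)).im) (𝓝[<] π) (𝓝 0) := by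
  obtain ⟨C, hC⟩ := exists_rpow_le_mul_add hα (half_pos hs)
  refine squeeze_zero_norm' (a := fun t => exp C * (π - t)) ?_ ?_
  · filter_upwards [Ioo_mem_nhdsLT (show π - π / 3 < π by linarith [pi_pos])] with t ht
    set x := realCurveLog α s t
    have h1 := norm_primitive_vertical_sub_le hK (x := x) (C := exp C) ht.2.le fun φ hφ => by
      rw [norm_laplaceKernel, exp_le_exp]
      have h2 : cos φ ≤ -(1 / 2) := by
        rw [← cos_pi_div_three, ← cos_pi_sub]
        exact cos_le_cos_of_nonneg_of_le_pi (by linarith [pi_pos]) hφ.2 (ht.1.le.trans hφ.1)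
      have h3 := hC (exp x) (exp_pos x).le
      rw [← exp_mul, mul_comm x] at h3
      have h4 : s * exp x * cos φ ≤ s * exp x * (-(1 / 2)) := by gcongr
      have h5 : exp (α * x) * -1 ≤ exp (α * x) * cos (α * φ) := by
        gcongr; exact neg_one_le_cos _
      linarith
    simpa using (Complex.abs_im_le_norm _).trans h1
  · have : Tendsto (fun t : ℝ => exp C * (π - t)) (𝓝 π) (𝓝 (exp C * (π - π))) := by
      exact (Continuous.tendsto (by fun_prop) _)
    rw [sub_self, mul_zero] at this
    exact this.mono_left nhdsWithin_le_nhds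

lemma measurable_realCurveExponent (α s : ℝ) : Measurable (realCurveExponent α s) := by
  unfold realCurveExponent
  fun_prop

lemma integrableOn_exp_neg_realCurveExponent {α : ℝ} (hα : α ∈ Ioo (0 : ℝ) 1) (s : ℝ) :
    IntegrableOn (fun θ => exp (-realCurveExponent α s θ)) (Ioo 0 π) := by
  refine Measure.integrableOn_of_bounded (M := 1) (by simp)
    (measurable_realCurveExponent α s).neg.exp.aestronglyMeasurable ?_
  filter_upwards [ae_restrict_mem measurableSet_Ioo] with θ hθ
  rw [norm_of_nonneg (exp_pos _).le, exp_le_one_iff]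
  exact neg_nonpos.2 (realCurveExponent_pos hα hθ).le

/-- Integrating Pollard's integrand over `s` in `(s, ∞)` gives this integrand. -/
noncomputable def stableTailIntegrand (α s v : ℝ) : ℝ :=
  exp (-s * v) * exp (-(v ^ α) * cos (π * α)) * sin ((v ^ α) * sin (π * α)) / v

lemma norm_exp_mul_exp_le {α s : ℝ} {C c v : ℝ} (hC : v ^ α ≤ c * v + C) (hv : 0 < v) :
    ‖exp (-s * v) * exp (-(v ^ α) * cos (π * α))‖ ≤ exp C * exp (-(s - c) * v) := by
  rw [← exp_add, ← exp_add, norm_of_nonneg (exp_pos _).le, exp_le_exp]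
  have := mul_le_mul_of_nonneg_left (neg_one_le_cos (π * α)) (rpow_nonneg hv.le α)
  linarith

lemma measurable_stableTailIntegrand (α s : ℝ) : Measurable (stableTailIntegrand α s) := by
  unfold stableTailIntegrand
  fun_prop

lemma integrableOn_stableTailIntegrand {α s : ℝ} (hα : α ∈ Ioo (0 : ℝ) 1) (hs : 0 < s) :
    IntegrableOn (stableTailIntegrand α s) (Ioi 0) := by
  obtain ⟨C, hC⟩ := exists_rpow_le_mul_add hα (half_pos hs)
  have hInt := (integrableOn_rpow_mul_exp_neg_mul_rpow (p := 1) (s := α - 1)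
    (by linarith [hα.1]) one_pos (half_pos hs)).const_mul (exp C)
  refine Integrable.mono' hInt (measurable_stableTailIntegrand α s).aestronglyMeasurable ?_
  filter_upwards [ae_restrict_mem measurableSet_Ioi] with v hv
  rw [mem_Ioi] at hv
  have h1 := norm_exp_mul_exp_le (s := s) (hC v hv.le) hv
  have h2 : ‖sin ((v ^ α) * sin (π * α))‖ ≤ v ^ α := by
    rw [norm_eq_abs]
    refine abs_sin_le_abs.trans ?_
    rw [abs_mul, abs_of_nonneg (rpow_nonneg hv.le α)]
    exact mul_le_of_le_one_right (rpow_nonneg hv.le α) (abs_sin_le_one _)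
  rw [stableTailIntegrand, norm_div, norm_mul, norm_of_nonneg hv.le, div_le_iff₀ hv]
  refine (mul_le_mul h1 h2 (norm_nonneg _) (by positivity)).trans_eq ?_
  rw [rpow_one, rpow_sub_one hv.ne', sub_half]
  field_simp

lemma hasDerivAt_primitive_im_log {α s v : ℝ} {K : ℂ → ℂ}
    (hK : ∀ w, HasDerivAt K (laplaceKernel α s w) w) (hv : 0 < v) :
    HasDerivAt (fun t : ℝ => (K (log t + π * Complex.I)).im) (-stableTailIntegrand α s v) v := by
  have h1 := (hasDerivAt_log hv.ne').ofReal_comp.add_const (π * Complex.I : ℂ)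
  have h2 := Complex.imCLM.hasFDerivAt.comp_hasDerivAt v ((hK _).comp v h1)
  refine h2.congr_deriv ?_
  rw [Complex.imCLM_apply, mul_comm, Complex.im_ofReal_mul, laplaceKernel_im, exp_log hv,
    mul_comm α, ← rpow_def_of_pos hv, cos_pi, sin_pi, stableTailIntegrand, ← exp_add,
    mul_zero, zero_sub, sin_neg, mul_comm α π]
  ring_nf

lemma exists_continuousWithinAt_extension {f : ℝ → ℝ} {a b : ℝ} (h : Tendsto f (𝓝[>] a) (𝓝 b)) :
    ∃ g : ℝ → ℝ, ContinuousWithinAt g (Ici a) a ∧ g a = b ∧ (∀ x ∈ Ioi a, g =ᶠ[𝓝 x] f) ∧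
      g =ᶠ[atTop] f := by
  have hne : ∀ x ∈ Ioi a, Function.update f a b x = f x :=
    fun x hx => Function.update_of_ne (ne_of_gt hx) _ _
  refine ⟨Function.update f a b, ?_, Function.update_self .., fun x hx => ?_, ?_⟩
  · rwa [continuousWithinAt_update_same, Ici_sdiff_left]
  · filter_upwards [Ioi_mem_nhds hx] with y hy using hne y hy
  · filter_upwards [Ioi_mem_atTop a] with y hy using hne y hy

lemma integral_stableTailIntegrand {α s : ℝ} (hα : α ∈ Ioo (0 : ℝ) 1) (hs : 0 < s) :
    ∫ v in Ioi 0, stableTailIntegrand α s v =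
      π - ∫ θ in Ioo 0 π, exp (-realCurveExponent α s θ) := by
  obtain ⟨K, hK, h0⟩ := exists_primitive_laplaceKernel α s
  set F : ℝ → ℝ := fun t => (K (log t + π * Complex.I)).im with hF
  have hder : ∀ v ∈ Ioi (0 : ℝ), HasDerivAt F (-stableTailIntegrand α s v) v :=
    fun v hv => hasDerivAt_primitive_im_log hK hv
  have hInt := (integrableOn_stableTailIntegrand hα hs).neg
  have hlim := tendsto_limUnder_of_hasDerivAt_of_integrableOn_Ioi hder hInt
  set L := limUnder atTop F
  have hzero : Tendsto F (𝓝[>] 0) (𝓝 π) :=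
    (tendsto_primitive_im_atBot hα.1 hK h0).comp tendsto_log_nhdsGT_zero
  obtain ⟨G, hG, hG0, hGF, hGF'⟩ := exists_continuousWithinAt_extension hzero
  have hI := integral_Ioi_of_hasDerivAt_of_tendsto hG
    (fun v hv => (hder v hv).congr_of_eventuallyEq (hGF v hv)) hInt (hlim.congr' hGF'.symm)
  have hpi : Tendsto (fun t : ℝ => (K (realCurveLog α s t + t * Complex.I)).im)
      (𝓝[<] π) (𝓝 L) := by
    have h1 := hlim.comp (tendsto_exp_atTop.comp (tendsto_realCurveLog_pi (s := s) hα))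
    have h2 := h1.sub (tendsto_primitive_im_realCurve_pi hα hs hK)
    rw [sub_zero] at h2
    refine h2.congr fun t => ?_
    simp [hF]
  have hE := intervalIntegral.integral_eq_sub_of_hasDerivAt_of_tendsto pi_pos
    (fun θ hθ => hasDerivAt_primitive_im_realCurve hα hs hK hθ)
    ((intervalIntegrable_iff_integrableOn_Ioo_of_le pi_pos.le).2
      (integrableOn_exp_neg_realCurveExponent hα s))
    (tendsto_primitive_im_realCurve_zero hα hs hK h0) hpi
  rw [intervalIntegral.integral_of_le pi_pos.le, integral_Ioc_eq_integral_Ioo] at hE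
  simp only [integral_neg, hG0] at hI
  linarith

lemma hasDerivAt_integral_stableTailIntegrand {α s : ℝ} (hα : α ∈ Ioo (0 : ℝ) 1) (hs : 0 < s) :
    HasDerivAt (fun t => ∫ v in Ioi 0, stableTailIntegrand α t v) (-(π * stableDensity α s)) s := by
  have hs2 := half_pos hs
  have hs4 := half_pos hs2
  obtain ⟨C, hC⟩ := exists_rpow_le_mul_add hα hs4
  have hInt := (integrableOn_exp_mul_Ioi (neg_lt_zero.2 hs4) 0).const_mul (exp C)
  have h := (hasDerivAt_integral_of_dominated_loc_of_deriv_le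
    (μ := volume.restrict (Ioi 0)) (F := stableTailIntegrand α)
    (F' := fun t v => -(exp (-t * v) * exp (-(v ^ α) * cos (π * α)) *
      sin ((v ^ α) * sin (π * α)))) (Ioi_mem_nhds (half_lt_self hs))
    (Eventually.of_forall fun t => (measurable_stableTailIntegrand α t).aestronglyMeasurable)
    (integrableOn_stableTailIntegrand hα hs)
    (Measurable.aestronglyMeasurable (by fun_prop)) ?_ hInt ?_).2
  · rw [integral_neg] at h
    rwa [stableDensity, one_div, mul_inv_cancel_left₀ pi_ne_zero]
  · filter_upwards [ae_restrict_mem measurableSet_Ioi] with v hv t ht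
    rw [mem_Ioi] at hv ht
    rw [norm_neg, norm_mul]
    have h1 := norm_exp_mul_exp_le (s := t) (hC v hv.le) hv
    refine (mul_le_of_le_one_right (norm_nonneg _) (abs_sin_le_one _)).trans (h1.trans ?_)
    gcongr
    linarith
  · filter_upwards [ae_restrict_mem measurableSet_Ioi] with v hv t ht
    rw [mem_Ioi] at hv
    have h1 : HasDerivAt (fun t : ℝ => exp (-t * v)) (exp (-t * v) * (-1 * v)) t :=
      ((hasDerivAt_neg t).mul_const v).exp
    have h2 := ((h1.mul_const (exp (-(v ^ α) * cos (π * α)))).mul_const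
      (sin ((v ^ α) * sin (π * α)))).div_const v
    refine h2.congr_deriv ?_
    field_simp

/-- `π` times the distribution function of the stable law. -/
noncomputable def stableCDFIntegral (α s : ℝ) : ℝ :=
  ∫ θ in Ioo 0 π, exp (-realCurveExponent α s θ)

lemma hasDerivAt_stableCDFIntegral {α s : ℝ} (hα : α ∈ Ioo (0 : ℝ) 1) (hs : 0 < s) :
    HasDerivAt (stableCDFIntegral α) (π * stableDensity α s) s := by
  have h := (hasDerivAt_integral_stableTailIntegrand hα hs).const_sub π
  rw [neg_neg] at h
  refine h.congr_of_eventuallyEq ?_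
  filter_upwards [Ioi_mem_nhds hs] with t ht
  rw [integral_stableTailIntegrand hα ht, stableCDFIntegral]
  ring

lemma monotoneOn_stableCDFIntegral {α : ℝ} (hα : α ∈ Ioo (0 : ℝ) 1) :
    MonotoneOn (stableCDFIntegral α) (Ioi 0) := by
  intro s hs t _ hst
  refine setIntegral_mono_on (integrableOn_exp_neg_realCurveExponent hα s)
    (integrableOn_exp_neg_realCurveExponent hα t) measurableSet_Ioo fun θ hθ => ?_
  have h1 := div_pos (sin_mul_pos (one_sub_mem_Ioo hα) hθ) (sin_mul_pos hα hθ)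
  have h2 := sub_pos.2 hα.2
  have h3 := mul_le_mul_of_nonneg_left (log_le_log hs hst) hα.1.le
  unfold realCurveExponent
  gcongr

lemma tendsto_stableCDFIntegral {α b : ℝ} (hα : α ∈ Ioo (0 : ℝ) 1) {l : Filter ℝ}
    [l.IsCountablyGenerated]
    (h : ∀ θ ∈ Ioo 0 π, Tendsto (fun s => exp (-realCurveExponent α s θ)) l (𝓝 b)) :
    Tendsto (stableCDFIntegral α) l (𝓝 (π * b)) := by
  have := tendsto_integral_filter_of_dominated_convergence (μ := volume.restrict (Ioo 0 π))
    (F := fun s θ => exp (-realCurveExponent α s θ)) (f := fun _ => b) (l := l) (fun _ => 1)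
    (Eventually.of_forall fun s =>
      (measurable_realCurveExponent α s).neg.exp.aestronglyMeasurable)
    (Eventually.of_forall fun s => by
      filter_upwards [ae_restrict_mem measurableSet_Ioo] with θ hθ
      rw [norm_of_nonneg (exp_pos _).le, exp_le_one_iff]
      exact neg_nonpos.2 (realCurveExponent_pos hα hθ).le)
    (by simp)
    (by filter_upwards [ae_restrict_mem measurableSet_Ioo] with θ hθ using h θ hθ)
  simpa [pi_pos.le, stableCDFIntegral] using! this

lemma tendsto_stableCDFIntegral_zero {α : ℝ} (hα : α ∈ Ioo (0 : ℝ) 1) :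
    Tendsto (stableCDFIntegral α) (𝓝[>] 0) (𝓝 0) := by
  suffices h : Tendsto (stableCDFIntegral α) (𝓝[>] 0) (𝓝 (π * 0)) by rwa [mul_zero] at h
  refine tendsto_stableCDFIntegral hα fun θ hθ => ?_
  have h1 := div_pos (sin_mul_pos (one_sub_mem_Ioo hα) hθ) (sin_mul_pos hα hθ)
  have h2 := tendsto_neg_atBot_atTop.comp (tendsto_log_nhdsGT_zero.const_mul_atBot hα.1)
  have h3 := (tendsto_atTop_add_const_left _ (log (sin (α * θ)) - log (sin θ)) h2).atTop_div_const
    (sub_pos.2 hα.2)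
  exact tendsto_exp_neg_atTop_nhds_zero.comp ((tendsto_exp_atTop.comp h3).atTop_mul_const h1)

lemma tendsto_stableCDFIntegral_atTop {α : ℝ} (hα : α ∈ Ioo (0 : ℝ) 1) :
    Tendsto (stableCDFIntegral α) atTop (𝓝 π) := by
  rw [← mul_one π]
  refine tendsto_stableCDFIntegral hα fun θ hθ => ?_
  have h2 := tendsto_neg_atTop_atBot.comp (tendsto_log_atTop.const_mul_atTop hα.1)
  have h3 := (tendsto_atBot_add_const_left _ (log (sin (α * θ)) - log (sin θ)) h2).atBot_div_const
    (sub_pos.2 hα.2)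
  have h4 := ((tendsto_exp_atBot.comp h3).mul_const (sin ((1 - α) * θ) / sin (α * θ))).neg
  rw [zero_mul, neg_zero] at h4
  simpa using! (continuous_exp.tendsto 0).comp h4

lemma stableDensity_nonneg_of_pos {α s : ℝ} (hα : α ∈ Ioo (0 : ℝ) 1) (hs : 0 < s) :
    0 ≤ stableDensity α s := by
  have h := (monotoneOn_stableCDFIntegral hα).derivWithin_nonneg (x := s)
  rw [derivWithin_of_isOpen isOpen_Ioi hs, (hasDerivAt_stableCDFIntegral hα hs).deriv] at h
  exact nonneg_of_mul_nonneg_right h pi_pos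

lemma stableDensity_zero_nonneg {α : ℝ} (hα : α ∈ Ioo (0 : ℝ) 1) : 0 ≤ stableDensity α 0 := by
  by_cases hInt : IntegrableOn (fun v => exp (-0 * v) * exp (-(v ^ α) * cos (π * α)) *
      sin ((v ^ α) * sin (π * α))) (Ioi 0)
  · have h : Tendsto (stableDensity α) (𝓝[>] 0) (𝓝 (stableDensity α 0)) := by
      refine Tendsto.const_mul _ (tendsto_integral_filter_of_dominated_convergence _
        (Eventually.of_forall fun s => Measurable.aestronglyMeasurable (by fun_prop)) ?_
        hInt.norm ?_)
      · filter_upwards [self_mem_nhdsWithin] with s hs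
        filter_upwards [ae_restrict_mem measurableSet_Ioi] with v hv
        rw [norm_mul, norm_mul, norm_mul, norm_mul]
        gcongr
        rw [norm_of_nonneg (exp_pos _).le, norm_of_nonneg (exp_pos _).le, exp_le_exp]
        have := mul_pos (mem_Ioi.1 hs) (mem_Ioi.1 hv)
        linarith
      · refine Eventually.of_forall fun v => Tendsto.mono_left ?_ nhdsWithin_le_nhds
        exact Continuous.tendsto (by fun_prop) 0
    refine ge_of_tendsto h ?_
    filter_upwards [self_mem_nhdsWithin] with s hs using stableDensity_nonneg_of_pos hα hs
  · rw [stableDensity, integral_undef hInt, mul_zero]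

/-- `g(α,·)` is nonnegative on `[0,∞)` and integrates to `1`: it is a probability density. -/
theorem stableDensity_isProbabilityDensity (α : ℝ) (hα : α ∈ Ioo (0 : ℝ) 1) :
    (∀ s : ℝ, 0 ≤ s → 0 ≤ stableDensity α s) ∧
      (∫ s in Ioi (0 : ℝ), stableDensity α s) = 1 := by
  refine ⟨fun s hs => ?_, ?_⟩
  · rcases hs.eq_or_lt with rfl | hs
    · exact stableDensity_zero_nonneg hα
    · exact stableDensity_nonneg_of_pos hα hs
  · obtain ⟨G, hG, hG0, hGF, hGF'⟩ :=
      exists_continuousWithinAt_extension (tendsto_stableCDFIntegral_zero hα)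
    have h := integral_Ioi_of_hasDerivAt_of_nonneg hG
      (fun s hs => (hasDerivAt_stableCDFIntegral hα hs).congr_of_eventuallyEq (hGF s hs))
      (fun s hs => mul_nonneg pi_pos.le (stableDensity_nonneg_of_pos hα hs))
      ((tendsto_stableCDFIntegral_atTop hα).congr' hGF'.symm)
    rw [integral_const_mul, hG0, sub_zero] at h
    exact (mul_eq_left₀ pi_ne_zero).1 h
end
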